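/- Any nondisturbing measurement by the second party is trivial on the 2p−1 states: if C is an n×n complex positive semidefinite (Hermitian) matrix with entries C_{ab} (0 ≤ a,b ≤ n−1) such that ⟨ψ_k, (I_m ⊗ C) ψ_l⟩ = 0 for all k, l with 1 ≤ k, l ≤ 2p−1 and k ≠ l, then ⟨ψ_k, (I_m ⊗ C) ψ_k⟩ = C_{00} for every k with 1 ≤ k ≤ 2p−1. -/

import Mathlib

open scoped ComplexInnerProductSpace Kronecker ComplexOrder

/-- The `i`-th standard basis vector `|i⟩` of `ℂ^m` (zero if `i ≥ m`). -/
noncomputable def ket (m i : ℕ) : EuclideanSpace ℂ (Fin m) :=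
  (WithLp.equiv 2 (Fin m → ℂ)).symm fun a => if (a : ℕ) = i then 1 else 0

/-- The product state `v ⊗ w`, with entries `(v ⊗ w)_{(a,b)} = v_a * w_b`. -/
noncomputable def tp {m n : ℕ} (v : EuclideanSpace ℂ (Fin m)) (w : EuclideanSpace ℂ (Fin n)) :
    EuclideanSpace ℂ (Fin m × Fin n) :=
  (WithLp.equiv 2 (Fin m × Fin n → ℂ)).symm fun ab => v ab.1 * w ab.2

/-- The scalar `1/√2`. -/
noncomputable def invSqrt2 : ℂ := ((Real.sqrt 2)⁻¹ : ℝ)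

/-- A matrix on `ℂ^m ⊗ ℂ^n` acting as a linear map. -/
noncomputable def act {m n : ℕ} (M : Matrix (Fin m × Fin n) (Fin m × Fin n) ℂ)
    (x : EuclideanSpace ℂ (Fin m × Fin n)) : EuclideanSpace ℂ (Fin m × Fin n) :=
  Matrix.toEuclideanLin M x

/-- The index `j(i)`: `j(i) = i + 1` for `i ≤ p - 2`, and `j(p-1) = 1`. -/
def jf (p i : ℕ) : ℕ := if i = p - 1 then 1 else i + 1

/-- The unnormalized uniform superposition `|0⟩ + |1⟩ + ⋯ + |p-1⟩` in `ℂ^m`. -/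
noncomputable def unif (m p : ℕ) : EuclideanSpace ℂ (Fin m) :=
  ∑ i ∈ Finset.range p, ket m i

/-- The `2p-1` product states `ψ_k` (`1 ≤ k ≤ 2p-1`) of Theorem 2:
`ψ_i = |i⟩ ⊗ (|0⟩-|i⟩)/√2`, `ψ_{i+p-1} = (|0⟩-|i⟩)/√2 ⊗ |j(i)⟩` for `1 ≤ i ≤ p-1`,
and `ψ_{2p-1} = (1/p)(|0⟩+⋯+|p-1⟩) ⊗ (|0⟩+⋯+|p-1⟩)`. -/
noncomputable def psi2 (m n p k : ℕ) : EuclideanSpace ℂ (Fin m × Fin n) :=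
  if k ≤ p - 1 then tp (ket m k) (invSqrt2 • (ket n 0 - ket n k))
  else if k ≤ 2 * p - 2 then
    tp (invSqrt2 • (ket m 0 - ket m (k - (p - 1)))) (ket n (jf p (k - (p - 1))))
  else ((p : ℂ))⁻¹ • tp (unif m p) (unif n p)

theorem inner_ket_ket {m i : ℕ} (k : ℕ) (hi : i < m) :
    ⟪ket m i, ket m k⟫ = if i = k then 1 else 0 := by
  rw [PiLp.inner_apply, Finset.sum_eq_single ⟨i, hi⟩]
  · simp [ket]
  · intro b _ hb
    have : (b : ℕ) ≠ i := fun e => hb (Fin.ext e)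
    simp [ket, this]
  · simp

theorem ket_ne_zero {m i : ℕ} (hi : i < m) : ket m i ≠ 0 := by
  intro h
  simpa [h] using inner_ket_ket i hi

theorem act_one_kronecker_tp {m n : ℕ} (C : Matrix (Fin n) (Fin n) ℂ)
    (v : EuclideanSpace ℂ (Fin m)) (w : EuclideanSpace ℂ (Fin n)) :
    act ((1 : Matrix (Fin m) (Fin m) ℂ) ⊗ₖ C) (tp v w) = tp v (Matrix.toEuclideanLin C w) := by
  ext ⟨a, b⟩
  simp [act, tp, Matrix.toLpLin_apply, Matrix.mulVec, dotProduct, Fintype.sum_prod_type,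
    Matrix.one_apply, ite_mul, Finset.mul_sum, mul_left_comm]

theorem inner_tp_tp {m n : ℕ} (v v' : EuclideanSpace ℂ (Fin m))
    (w w' : EuclideanSpace ℂ (Fin n)) :
    ⟪tp v w, tp v' w'⟫ = ⟪v, v'⟫ * ⟪w, w'⟫ := by
  simp only [PiLp.inner_apply, Fintype.sum_prod_type, Finset.sum_mul_sum]
  refine Finset.sum_congr rfl fun a _ => Finset.sum_congr rfl fun b _ => ?_
  simp [tp]
  ring

theorem inner_tp_act_tp {m n : ℕ} (C : Matrix (Fin n) (Fin n) ℂ)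
    (v v' : EuclideanSpace ℂ (Fin m)) (w w' : EuclideanSpace ℂ (Fin n)) :
    ⟪tp v w, act ((1 : Matrix (Fin m) (Fin m) ℂ) ⊗ₖ C) (tp v' w')⟫ =
      ⟪v, v'⟫ * ⟪w, Matrix.toEuclideanLin C w'⟫ := by
  rw [act_one_kronecker_tp, inner_tp_tp]

theorem inner_ket_toEuclideanLin_ket {n : ℕ} (C : Matrix (Fin n) (Fin n) ℂ) (a b : Fin n) :
    ⟪ket n a, Matrix.toEuclideanLin C (ket n b)⟫ = C a b := by
  simp [ket, PiLp.inner_apply, Matrix.toLpLin_apply, Matrix.mulVec, dotProduct, Fin.val_inj]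

theorem invSqrt2_mul_self : invSqrt2 * invSqrt2 = 1 / 2 := by
  rw [invSqrt2, ← Complex.ofReal_mul, ← mul_inv, Real.mul_self_sqrt (by norm_num)]
  norm_num

theorem invSqrt2_ne_zero : invSqrt2 ≠ 0 := by
  intro h
  simpa [h] using invSqrt2_mul_self

theorem conj_invSqrt2 : (starRingEnd ℂ) invSqrt2 = invSqrt2 :=
  Complex.conj_ofReal _

theorem psi2_of_le {m n p i : ℕ} (hi : i ≤ p - 1) :
    psi2 m n p i = tp (ket m i) (invSqrt2 • (ket n 0 - ket n i)) :=
  if_pos hi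

theorem psi2_add {m n p i : ℕ} (h1 : 1 ≤ i) (hi : i ≤ p - 1) :
    psi2 m n p (i + (p - 1)) =
      tp (invSqrt2 • (ket m 0 - ket m i)) (ket n (jf p i)) := by
  rw [psi2, if_neg (by omega), if_pos (by omega), Nat.add_sub_cancel]

theorem psi2_last {m n p : ℕ} (hp : 1 ≤ p) :
    psi2 m n p (2 * p - 1) = ((p : ℂ))⁻¹ • tp (unif m p) (unif n p) := by
  rw [psi2, if_neg (by omega), if_neg (by omega)]

theorem exists_jf_eq {p a : ℕ} (h3 : 3 ≤ p) (h1 : 1 ≤ a) (ha : a < p) :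
    ∃ i, 1 ≤ i ∧ i ≤ p - 1 ∧ jf p i = a ∧ i ≠ a := by
  obtain rfl | h : a = 1 ∨ 2 ≤ a := by omega
  · exact ⟨p - 1, by omega, le_rfl, if_pos rfl, by omega⟩
  · refine ⟨a - 1, by omega, by omega, ?_, by omega⟩
    rw [jf, if_neg (by omega)]
    omega

theorem jf_bounds {p i : ℕ} (h3 : 3 ≤ p) (hi : i ≤ p - 1) : 1 ≤ jf p i ∧ jf p i < p := by
  unfold jf
  split_ifs <;> omega

theorem inner_ket_unif {m p i : ℕ} (hi : i < p) (hpm : p ≤ m) : ⟪ket m i, unif m p⟫ = 1 := by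
  simp [unif, inner_ket_ket _ (hi.trans_le hpm), hi]

theorem inner_unif_unif {m p : ℕ} (hpm : p ≤ m) : ⟪unif m p, unif m p⟫ = (p : ℂ) := by
  conv_lhs => rw [unif, sum_inner]
  rw [← unif, Finset.sum_congr rfl fun i hi => inner_ket_unif (Finset.mem_range.1 hi) hpm]
  simp

theorem inner_ket_toEuclideanLin_unif {n p a : ℕ} (C : Matrix (Fin n) (Fin n) ℂ) (ha : a < p)
    (hC : ∀ b < p, a ≠ b → ⟪ket n a, Matrix.toEuclideanLin C (ket n b)⟫ = 0) :
    ⟪ket n a, Matrix.toEuclideanLin C (unif n p)⟫ =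
      ⟪ket n a, Matrix.toEuclideanLin C (ket n a)⟫ := by
  rw [unif, map_sum, inner_sum]
  refine Finset.sum_eq_single a (fun b hb hba => hC b (Finset.mem_range.1 hb) hba.symm) ?_
  simp [ha]

theorem bob_measurement_trivial_small_basis (p m n : ℕ) (h3 : 3 ≤ p) (hpm : p ≤ m)
    (hmn : m ≤ n)
    (C : Matrix (Fin n) (Fin n) ℂ) (hC : C.PosSemidef)
    (h : ∀ k l : ℕ, 1 ≤ k → k ≤ 2 * p - 1 → 1 ≤ l → l ≤ 2 * p - 1 → k ≠ l →
      ⟪psi2 m n p k, act ((1 : Matrix (Fin m) (Fin m) ℂ) ⊗ₖ C) (psi2 m n p l)⟫ = 0) :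
    ∀ k, 1 ≤ k → k ≤ 2 * p - 1 →
      ⟪psi2 m n p k, act ((1 : Matrix (Fin m) (Fin m) ℂ) ⊗ₖ C) (psi2 m n p k)⟫ =
        C (⟨0, by omega⟩ : Fin n) (⟨0, by omega⟩ : Fin n) := by
  have hm : 0 < m := by omega
  have hpos : ∀ a b, 1 ≤ a → a < p → 1 ≤ b → b < p → a ≠ b →
      ⟪ket n a, Matrix.toEuclideanLin C (ket n b)⟫ = 0 := by
    intro a b ha1 ha hb1 hb hab
    obtain ⟨i, hi1, hi, rfl, -⟩ := exists_jf_eq h3 ha1 ha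
    obtain ⟨k, hk1, hk, rfl, -⟩ := exists_jf_eq h3 hb1 hb
    have hik : i ≠ k := by rintro rfl; exact hab rfl
    have := h (i + (p - 1)) (k + (p - 1)) (by omega) (by omega) (by omega) (by omega) (by omega)
    rw [psi2_add hi1 hi, psi2_add hk1 hk, inner_tp_act_tp] at this
    simpa [inner_smul_left, inner_smul_right, inner_sub_left, inner_sub_right, invSqrt2_ne_zero,
      inner_ket_ket _ hm, inner_ket_ket _ (show i < m by omega), hik, conj_invSqrt2,
      ket_ne_zero hm,
      (show 0 ≠ k by omega), (show i ≠ 0 by omega)] using this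
  have hzero_left : ∀ a, 1 ≤ a → a < p → ⟪ket n 0, Matrix.toEuclideanLin C (ket n a)⟫ = 0 := by
    intro a ha1 ha
    obtain ⟨i, hi1, hi, rfl, hia⟩ := exists_jf_eq h3 ha1 ha
    have := h i (i + (p - 1)) (by omega) (by omega) (by omega) (by omega) (by omega)
    rw [psi2_of_le hi, psi2_add hi1 hi, inner_tp_act_tp] at this
    simpa [inner_smul_left, inner_smul_right, inner_sub_left, inner_sub_right, invSqrt2_ne_zero,
      inner_ket_ket _ (show i < m by omega), conj_invSqrt2, (show i ≠ 0 by omega),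
      ket_ne_zero (show i < m by omega), hpos i _ hi1 (by omega) ha1 ha hia] using this
  have hzero_right : ∀ a, 1 ≤ a → a < p → ⟪ket n a, Matrix.toEuclideanLin C (ket n 0)⟫ = 0 := by
    intro a ha1 ha
    obtain ⟨i, hi1, hi, rfl, hia⟩ := exists_jf_eq h3 ha1 ha
    have := h (i + (p - 1)) i (by omega) (by omega) (by omega) (by omega) (by omega)
    rw [psi2_of_le hi, psi2_add hi1 hi, inner_tp_act_tp] at this
    simpa [inner_smul_left, inner_smul_right, inner_sub_left, inner_sub_right, invSqrt2_ne_zero,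
      inner_ket_ket _ hm, inner_ket_ket _ (show i < m by omega), conj_invSqrt2,
      (show 0 ≠ i by omega),
      ket_ne_zero (show i < m by omega), hpos _ i ha1 ha hi1 (by omega) hia.symm] using this
  have hoff : ∀ a < p, ∀ b < p, a ≠ b → ⟪ket n a, Matrix.toEuclideanLin C (ket n b)⟫ = 0 := by
    intro a ha b hb hab
    obtain rfl | ha1 := Nat.eq_zero_or_pos a
    · exact hzero_left b (by omega) hb
    obtain rfl | hb1 := Nat.eq_zero_or_pos b
    · exact hzero_right a ha1 ha
    · exact hpos a b ha1 ha hb1 hb hab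
  have h00 : ⟪ket n 0, Matrix.toEuclideanLin C (ket n 0)⟫ =
      C (⟨0, by omega⟩ : Fin n) (⟨0, by omega⟩ : Fin n) :=
    inner_ket_toEuclideanLin_ket C ⟨0, by omega⟩ ⟨0, by omega⟩
  rw [← h00]
  have hunif : ∀ a < p, ⟪ket n a, Matrix.toEuclideanLin C (unif n p)⟫ =
      ⟪ket n a, Matrix.toEuclideanLin C (ket n a)⟫ := fun a ha =>
    inner_ket_toEuclideanLin_unif C ha (hoff a ha)
  have hp0 : (p : ℂ) ≠ 0 := Nat.cast_ne_zero.2 (by omega)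
  have hdiag : ∀ a < p, ⟪ket n a, Matrix.toEuclideanLin C (ket n a)⟫ =
      ⟪ket n 0, Matrix.toEuclideanLin C (ket n 0)⟫ := by
    intro a ha
    obtain rfl | ha1 := Nat.eq_zero_or_pos a
    · rfl
    have := h a (2 * p - 1) (by omega) (by omega) (by omega) le_rfl (by omega)
    rw [psi2_of_le (by omega), psi2_last (by omega), act, map_smul, ← act, inner_smul_right,
      inner_tp_act_tp, inner_ket_unif ha hpm, inner_smul_left, inner_sub_left, hunif a ha,
      hunif 0 (by omega), conj_invSqrt2] at this
    exact Eq.symm (by simpa [hp0, invSqrt2_ne_zero, sub_eq_zero] using this)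
  intro k hk1 hk
  obtain hkp | hkp | rfl : k ≤ p - 1 ∨ (∃ i, 1 ≤ i ∧ i ≤ p - 1 ∧ k = i + (p - 1)) ∨
      k = 2 * p - 1 := by
    by_cases hkp : k ≤ p - 1
    · exact Or.inl hkp
    by_cases hk2 : k = 2 * p - 1
    · exact Or.inr (Or.inr hk2)
    · exact Or.inr (Or.inl ⟨k - (p - 1), by omega, by omega, by omega⟩)
  · rw [psi2_of_le hkp, inner_tp_act_tp, inner_ket_ket _ (by omega), if_pos rfl, map_smul,
      inner_smul_left, inner_smul_right, conj_invSqrt2, map_sub, inner_sub_left, inner_sub_right,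
      inner_sub_right, hdiag k (by omega), hoff 0 (by omega) k (by omega) (by omega),
      hoff k (by omega) 0 (by omega) (by omega)]
    linear_combination 2 * ⟪ket n 0, Matrix.toEuclideanLin C (ket n 0)⟫ * invSqrt2_mul_self
  · obtain ⟨i, hi1, hi, rfl⟩ := hkp
    rw [psi2_add hi1 hi, inner_tp_act_tp, hdiag _ (jf_bounds h3 hi).2, inner_smul_left,
      inner_smul_right, conj_invSqrt2, inner_sub_left, inner_sub_right, inner_sub_right,
      inner_ket_ket _ hm, inner_ket_ket _ hm, inner_ket_ket _ (by omega),
      inner_ket_ket _ (by omega), if_pos rfl, if_neg (by omega), if_neg (by omega), if_pos rfl]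
    linear_combination 2 * ⟪ket n 0, Matrix.toEuclideanLin C (ket n 0)⟫ * invSqrt2_mul_self
  · have hsum : ⟪unif n p, Matrix.toEuclideanLin C (unif n p)⟫ =
        p * ⟪ket n 0, Matrix.toEuclideanLin C (ket n 0)⟫ := by
      have : ⟪unif n p, Matrix.toEuclideanLin C (unif n p)⟫ =
          ∑ a ∈ Finset.range p, ⟪ket n a, Matrix.toEuclideanLin C (unif n p)⟫ :=
        sum_inner _ _ _
      rw [this, Finset.sum_congr rfl fun a ha =>
        (hunif a (Finset.mem_range.1 ha)).trans (hdiag a (Finset.mem_range.1 ha))]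
      simp
    rw [psi2_last (by omega), act, map_smul, ← act, inner_smul_left, inner_smul_right,
      inner_tp_act_tp, inner_unif_unif hpm, hsum, map_inv₀, Complex.conj_natCast]
    field_simp
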